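/- arXiv:2210.07326 — 2 statements merged into one kernel-verified Lean document; each statement's English description precedes it below -/
import Mathlib

section
/- Let Ω ⊆ ℂ be an LMI region determined by a real symmetric s×s matrix B and a real s×s matrix C. A real n×n matrix A is Ω-stable if and only if A = (J − R)Q for some real n×n matrices J, R, Q with Jᵀ = −J, Rᵀ = R, Q symmetric positive definite, and such that the real symmetric ns×ns matrix B ⊗ Q⁻¹ + (C − Cᵀ) ⊗ J − (C + Cᵀ) ⊗ R is negative definite (⊗ is the Kronecker product). -/
open Matrix Kronecker
open scoped ComplexOrder

/-- The matrix `B ⊗ X + C ⊗ (A X) + Cᴴ ⊗ (A X)ᴴ` associated with an LMI region. -/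
def lmiMatrix {R ι κ : Type*} [CommSemiring R] [StarRing R] [Fintype κ]
    (B C : Matrix ι ι R) (X A : Matrix κ κ R) : Matrix (ι × κ) (ι × κ) R :=
  B ⊗ₖ X + C ⊗ₖ (A * X) + Cᴴ ⊗ₖ (A * X)ᴴ

theorem lmiMatrix_isHermitian {R ι κ : Type*} [CommRing R] [StarRing R] [Fintype κ]
    {B C : Matrix ι ι R} {X A : Matrix κ κ R} (hB : B.IsHermitian) (hX : X.IsHermitian) :
    (lmiMatrix B C X A).IsHermitian := by
  simp only [lmiMatrix, IsHermitian, conjTranspose_add, conjTranspose_kronecker, hB.eq, hX.eq,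
    conjTranspose_conjTranspose]
  abel

/-- Congruence by `1 ⊗ S`, where `S` intertwines two matrices. -/
theorem lmiMatrix_congr {R ι κ : Type*} [CommRing R] [StarRing R] [Fintype ι] [DecidableEq ι]
    [Fintype κ] [DecidableEq κ] {B C : Matrix ι ι R} {A A' S : Matrix κ κ R}
    (h : A * S = S * A') :
    lmiMatrix B C (S * Sᴴ) A =
      ((1 : Matrix ι ι R) ⊗ₖ S) * lmiMatrix B C 1 A' * ((1 : Matrix ι ι R) ⊗ₖ S)ᴴ := by
  have h1 : A * (S * Sᴴ) = S * A' * Sᴴ := by rw [← h, Matrix.mul_assoc]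
  simp only [lmiMatrix, h1, conjTranspose_kronecker, conjTranspose_one, Matrix.mul_add,
    Matrix.add_mul, ← mul_kronecker_mul, Matrix.one_mul, Matrix.mul_one, conjTranspose_mul,
    conjTranspose_conjTranspose, Matrix.mul_assoc]

namespace Matrix

variable {ι : Type*} [Fintype ι]

theorem PosDef.map_re {M : Matrix ι ι ℂ} (hM : M.PosDef) : (M.map Complex.re).PosDef := by
  refine .of_dotProduct_mulVec_pos ?_ fun x hx ↦ ?_
  · ext i j
    simpa using congrArg Complex.re (hM.isHermitian.apply i j)
  · have hx' : (fun i ↦ (x i : ℂ)) ≠ 0 := fun h ↦ hx <| by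
      ext i
      simpa using congrFun h i
    have := (Complex.lt_def.1 (hM.dotProduct_mulVec_pos hx')).1
    simpa [dotProduct, mulVec] using this

theorem PosDef.map_ofReal {M : Matrix ι ι ℝ} (hM : M.PosDef) :
    (M.map Complex.ofReal).PosDef := by
  have hH : (M.map Complex.ofReal).IsHermitian := by
    ext i j
    simpa using hM.isHermitian.apply i j
  refine .of_dotProduct_mulVec_pos hH fun x hx ↦ ?_
  rw [Complex.lt_def]
  refine ⟨?_, (hH.im_star_dotProduct_mulVec_self x).symm⟩
  have key : (star x ⬝ᵥ (M.map Complex.ofReal *ᵥ x)).re =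
      star (fun i ↦ (x i).re) ⬝ᵥ (M *ᵥ fun i ↦ (x i).re) +
      star (fun i ↦ (x i).im) ⬝ᵥ (M *ᵥ fun i ↦ (x i).im) := by
    simp [dotProduct, mulVec, Finset.sum_add_distrib]
  rw [key, Complex.zero_re]
  have hnn := fun y ↦ hM.posSemidef.dotProduct_mulVec_nonneg y
  by_cases hre : (fun i ↦ (x i).re) = 0
  · have him : (fun i ↦ (x i).im) ≠ 0 := fun him ↦ hx <| by
      ext i
      exact Complex.ext (congrFun hre i) (congrFun him i)
    exact add_pos_of_nonneg_of_pos (hnn _) (hM.dotProduct_mulVec_pos him)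
  · exact add_pos_of_pos_of_nonneg (hM.dotProduct_mulVec_pos hre) (hnn _)

open Topology in
/-- Positive definiteness is an open condition along continuous families of Hermitian matrices. -/
theorem PosDef.eventually {E : Type*} [TopologicalSpace E] {G : E → Matrix ι ι ℂ}
    (hG : Continuous G) (hH : ∀ e, (G e).IsHermitian) {e₀ : E} (h₀ : (G e₀).PosDef) :
    ∀ᶠ e in 𝓝 e₀, (G e).PosDef := by
  have hc : Continuous fun p : E × (ι → ℂ) ↦ (star p.2 ⬝ᵥ (G p.1 *ᵥ p.2)).re := by
    fun_prop
  have := (isCompact_sphere (0 : ι → ℂ) 1).eventually_forall_of_forall_eventually (x₀ := e₀)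
    (P := fun e x ↦ 0 < (star x ⬝ᵥ (G e *ᵥ x)).re) fun y hy ↦ by
      refine hc.continuousAt.eventually (lt_mem_nhds ?_)
      exact h₀.re_dotProduct_pos (ne_zero_of_mem_unit_sphere ⟨y, hy⟩)
  filter_upwards [this] with e he
  refine .of_dotProduct_mulVec_pos (hH e) fun x hx ↦ ?_
  rw [Complex.lt_def]
  refine ⟨?_, ((hH e).im_star_dotProduct_mulVec_self x).symm⟩
  have hn : 0 < ‖x‖ := norm_pos_iff.2 hx
  have h1 := he (((‖x‖⁻¹ : ℝ) : ℂ) • x) (by simp [norm_smul, hn.ne'])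
  simp only [star_smul, smul_dotProduct, mulVec_smul, dotProduct_smul, smul_eq_mul,
    Complex.star_def, Complex.conj_ofReal, Complex.re_ofReal_mul] at h1
  have hp : 0 < ‖x‖⁻¹ := inv_pos.2 hn
  exact pos_of_mul_pos_right (pos_of_mul_pos_right h1 hp.le) hp.le

theorem PosDef.blockDiagonal {κ : Type*} [Fintype κ] [DecidableEq κ] {M : κ → Matrix ι ι ℂ}
    (hM : ∀ k, (M k).PosDef) : (Matrix.blockDiagonal M).PosDef := by
  refine .of_dotProduct_mulVec_pos ?_ fun x hx ↦ ?_
  · rw [IsHermitian, blockDiagonal_conjTranspose]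
    congr 1
    ext1 k
    exact (hM k).isHermitian
  · have key : star x ⬝ᵥ (Matrix.blockDiagonal M *ᵥ x) =
        ∑ k, star (fun i ↦ x (i, k)) ⬝ᵥ (M k *ᵥ fun i ↦ x (i, k)) := by
      simp [dotProduct, mulVec, Fintype.sum_prod_type_right, blockDiagonal_apply, ite_mul]
    rw [key]
    obtain ⟨⟨i, k⟩, hik⟩ := Function.ne_iff.1 hx
    refine Finset.sum_pos' (fun k _ ↦ (hM k).posSemidef.dotProduct_mulVec_nonneg _)
      ⟨k, Finset.mem_univ k, (hM k).dotProduct_mulVec_pos fun h ↦ hik (congrFun h i)⟩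

end Matrix

open Module in
/-- An endomorphism of a complex vector space is, in suitable bases, arbitrarily close to a fixed
diagonal matrix of eigenvalues. -/
theorem Module.End.exists_basis_near_diagonal (n : ℕ) :
    ∀ {V : Type*} [AddCommGroup V] [Module ℂ V] [FiniteDimensional ℂ V], finrank ℂ V = n →
    ∀ T : End ℂ V, ∃ μ : Fin n → ℂ, (∀ i, T.HasEigenvalue (μ i)) ∧ ∀ ε > 0,
      ∃ b : Basis (Fin n) ℂ V, ∀ i j, ‖b.repr (T (b j) - μ j • b j) i‖ < ε := by
  induction n with
  | zero =>
    intro V _ _ _ hV T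
    exact ⟨Fin.elim0, fun i ↦ i.elim0, fun ε _ ↦ ⟨finBasisOfFinrankEq ℂ V hV, fun i ↦ i.elim0⟩⟩
  | succ n ih =>
    intro V _ _ _ hV T
    have : Nontrivial V := nontrivial_of_finrank_eq_succ hV
    obtain ⟨z, hz⟩ := exists_eigenvalue T
    have hlt : LinearMap.range (T - algebraMap ℂ (End ℂ V) z) < ⊤ := by
      rw [lt_top_iff_ne_top]
      intro htop
      have hker := LinearMap.ker_eq_bot_iff_range_eq_top.2 htop
      exact hz (by rwa [← eigenspace, eigenspace_def, ← Algebra.algebraMap_eq_smul_one])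
    obtain ⟨φ, hφ, hrange⟩ := Submodule.exists_le_ker_of_lt_top _ hlt
    have hT : ∀ v, T v - z • v ∈ LinearMap.ker φ := fun v ↦ hrange ⟨v, by simp⟩
    have hinv : ∀ v ∈ LinearMap.ker φ, T v ∈ LinearMap.ker φ := fun v hv ↦ by
      simpa using add_mem (hT v) (Submodule.smul_mem _ z hv)
    have hrank : finrank ℂ (LinearMap.ker φ) = n := by
      have := Module.Dual.finrank_ker_add_one_of_ne_zero hφ
      omega
    obtain ⟨μ, hμ, hb⟩ := ih hrank (T.restrict hinv)
    have heig : ∀ i, T.HasEigenvalue ((Fin.cons z μ : Fin (n + 1) → ℂ) i) := by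
      intro i
      induction i using Fin.cases with
      | zero => exact hz
      | succ i =>
        obtain ⟨v, hv⟩ := (hμ i).exists_hasEigenvector
        rw [Fin.cons_succ]
        refine hasEigenvalue_of_hasEigenvector (x := (v : V))
          ⟨mem_eigenspace_iff.2 ?_, by simpa using hv.2⟩
        simpa using congrArg Subtype.val hv.apply_eq_smul
    refine ⟨Fin.cons z μ, heig, fun ε hε ↦ ?_⟩
    obtain ⟨b, hb⟩ := hb ε hε
    obtain ⟨u, hu⟩ : ∃ u, φ u ≠ 0 := by
      by_contra! h
      exact hφ (LinearMap.ext h)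
    set w : LinearMap.ker φ := ⟨T u - z • u, hT u⟩ with hw
    set K : ℝ := 1 + ∑ i, ‖b.repr w i‖ with hK
    have hK0 : 0 < K := by positivity
    set δ : ℂ := ((ε / K : ℝ) : ℂ) with hδ
    have hδ0 : δ ≠ 0 := by
      rw [hδ, Complex.ofReal_ne_zero]
      positivity
    have hδu : φ (δ • u) ≠ 0 := by simp [hδ0, hu]
    let b' : Basis (Fin (n + 1)) ℂ V := Basis.mkFinCons (δ • u) b
      (fun c x hx h ↦ by
        have := congrArg φ h
        rw [map_add, map_smul, LinearMap.mem_ker.1 hx, add_zero, map_zero, smul_eq_mul] at this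
        exact (mul_eq_zero.1 this).resolve_right hδu)
      (fun v ↦ ⟨-(φ v / φ (δ • u)), by
        rw [LinearMap.mem_ker, map_add, map_smul, smul_eq_mul]
        field_simp
        ring⟩)
    have hb0 : b' 0 = δ • u := by simp [b', Basis.coe_mkFinCons]
    have hbs : ∀ i : Fin n, b' i.succ = b i := fun i ↦ by simp [b', Basis.coe_mkFinCons]
    have hrepr : ∀ h : LinearMap.ker φ, ∀ i,
        b'.repr (h : V) i = (Fin.cons 0 (b.repr h) : Fin (n + 1) → ℂ) i := by
      intro h i
      have : (h : V) = b'.equivFun.symm (Fin.cons 0 (b.repr h)) := by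
        rw [Basis.equivFun_symm_apply, Fin.sum_univ_succ]
        conv_lhs => rw [← b.sum_repr h]
        simp [hbs, -Basis.sum_repr]
      rw [← Basis.equivFun_apply, this, LinearEquiv.apply_symm_apply]
    refine ⟨b', fun i j ↦ ?_⟩
    induction j using Fin.cases with
    | zero =>
      have h1 : T (b' 0) - (Fin.cons z μ : Fin (n + 1) → ℂ) 0 • b' 0 =
          ((δ • w : LinearMap.ker φ) : V) := by
        simp [hb0, hw, smul_sub, smul_comm z δ]
      rw [h1, hrepr]
      induction i using Fin.cases with
      | zero => simpa using hε
      | succ i =>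
        have hi : ‖b.repr w i‖ < K := by
          have := Finset.single_le_sum (f := fun i ↦ ‖b.repr w i‖) (fun i _ ↦ norm_nonneg _)
            (Finset.mem_univ i)
          linarith
        have hδn : ‖δ‖ = ε / K := by
          rw [hδ, Complex.norm_real, Real.norm_of_nonneg (by positivity)]
        simp only [Fin.cons_succ, map_smul, Finsupp.smul_apply, norm_smul, hδn]
        rw [div_mul_eq_mul_div, div_lt_iff₀ hK0]
        gcongr
    | succ j =>
      have h1 : T (b' j.succ) - (Fin.cons z μ : Fin (n + 1) → ℂ) j.succ • b' j.succ =
          ((T.restrict hinv (b j) - μ j • b j : LinearMap.ker φ) : V) := by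
        simp [hbs]
      rw [h1, hrepr]
      induction i using Fin.cases with
      | zero => simpa using hε
      | succ i => simpa using hb i j

theorem neg_lmiMatrix_one_diagonal {ι κ : Type*} [Fintype κ] [DecidableEq κ]
    (B C : Matrix ι ι ℂ) (μ : κ → ℂ) :
    -lmiMatrix B C 1 (diagonal μ) =
      Matrix.blockDiagonal fun k ↦ -(B + μ k • C + (starRingEnd ℂ) (μ k) • Cᴴ) := by
  ext ⟨i, k⟩ ⟨j, l⟩
  by_cases h : k = l
  · subst h
    simp [lmiMatrix, blockDiagonal_apply, diagonal_conjTranspose, mul_comm]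
  · simp [lmiMatrix, blockDiagonal_apply, diagonal_conjTranspose, h]

/-- If all eigenvalues of `A` lie in the LMI region, the Lyapunov-type inequality has a complex
positive definite solution. -/
theorem exists_posDef_neg_lmiMatrix {ι : Type*} [Fintype ι] [DecidableEq ι] {n : ℕ}
    {B C : Matrix ι ι ℂ} (hB : B.IsHermitian) {A : Matrix (Fin n) (Fin n) ℂ}
    (h : ∀ z, A.charpoly.IsRoot z → (-(B + z • C + (starRingEnd ℂ) z • Cᴴ)).PosDef) :
    ∃ X : Matrix (Fin n) (Fin n) ℂ, X.PosDef ∧ (-lmiMatrix B C X A).PosDef := by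
  obtain ⟨μ, hμ, hbasis⟩ := Module.End.exists_basis_near_diagonal n (by simp) (toLin' A)
  have hdiag : (-lmiMatrix B C 1 (diagonal μ)).PosDef := by
    rw [neg_lmiMatrix_one_diagonal]
    refine PosDef.blockDiagonal fun k ↦ h _ ?_
    have := (Module.End.hasEigenvalue_iff_isRoot_charpoly _ _).1 (hμ k)
    rwa [charpoly_toLin'] at this
  have hev := PosDef.eventually (G := fun E : Fin n → Fin n → ℂ ↦
      -lmiMatrix B C 1 (diagonal μ + Matrix.of E)) (e₀ := 0)
    (by
      refine continuous_matrix fun p q ↦ ?_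
      simp only [lmiMatrix, Matrix.mul_one, Matrix.neg_apply, Matrix.add_apply, kroneckerMap_apply,
        conjTranspose_apply, of_apply]
      fun_prop)
    (fun E ↦ (lmiMatrix_isHermitian hB isHermitian_one).neg)
    (by
      change (-lmiMatrix B C 1 (diagonal μ + 0)).PosDef
      rwa [add_zero])
  obtain ⟨ε, hε, hball⟩ := Metric.eventually_nhds_iff.1 hev
  obtain ⟨b, hb⟩ := hbasis ε hε
  set E : Fin n → Fin n → ℂ := fun i j ↦ b.repr (toLin' A (b j) - μ j • b j) i with hE
  have hpos := @hball E (by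
    rw [dist_pi_lt_iff hε]
    intro i
    rw [dist_pi_lt_iff hε]
    intro j
    rw [Pi.zero_apply, Pi.zero_apply, dist_zero_right]
    exact hb i j)
  set S : Matrix (Fin n) (Fin n) ℂ := (Pi.basisFun ℂ (Fin n)).toMatrix b with hS
  have hSu : IsUnit S := (Matrix.isUnit_iff_isUnit_det S).2
    (Matrix.isUnit_det_of_right_inverse
      ((Pi.basisFun ℂ (Fin n)).toMatrix_mul_toMatrix_flip b))
  have hAS : A * S = S * (diagonal μ + Matrix.of E) := by
    ext i j
    have h1 := congrFun (b.sum_repr (toLin' A (b j) - μ j • b j)) i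
    simp only [Finset.sum_apply, Pi.smul_apply, smul_eq_mul, Pi.sub_apply, toLin'_apply] at h1
    rw [Matrix.mul_add, Matrix.add_apply, mul_diagonal]
    have h2 : (A * S) i j = (A *ᵥ b j) i := by
      simp [hS, Matrix.mul_apply, mulVec, dotProduct, Module.Basis.toMatrix_apply]
    have h3 : (S * Matrix.of E) i j = (A *ᵥ b j) i - μ j * b j i := by
      rw [← h1]
      simp [hS, hE, Matrix.mul_apply, Module.Basis.toMatrix_apply, mul_comm]
    rw [h2, h3]
    simp [hS, Module.Basis.toMatrix_apply, mul_comm]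
  refine ⟨S * Sᴴ, ?_, ?_⟩
  · exact PosDef.mul_conjTranspose_self S (vecMul_injective_of_isUnit hSu)
  · rw [lmiMatrix_congr hAS, ← Matrix.neg_mul, ← Matrix.mul_neg]
    refine hpos.mul_mul_conjTranspose_same (vecMul_injective_of_isUnit ?_)
    rw [Matrix.isUnit_iff_isUnit_det, det_kronecker, det_one, one_pow, one_mul]
    exact ((Matrix.isUnit_iff_isUnit_det S).1 hSu).pow _

/-- If the Lyapunov-type inequality has a positive definite solution, all eigenvalues of `A` lie in
the LMI region. -/
theorem posDef_of_isRoot_charpoly {ι κ : Type*} [Fintype ι] [DecidableEq ι] [Fintype κ]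
    [DecidableEq κ] {B C : Matrix ι ι ℂ} {X A : Matrix κ κ ℂ} (hX : X.PosDef)
    (h : (-lmiMatrix B C X A).PosDef) {z : ℂ} (hz : A.charpoly.IsRoot z) :
    (-(B + z • C + (starRingEnd ℂ) z • Cᴴ)).PosDef := by
  rw [← charpoly_transpose, ← charpoly_toLin', ← Module.End.hasEigenvalue_iff_isRoot_charpoly] at hz
  obtain ⟨v, hv⟩ := hz.exists_hasEigenvector
  have hvA := hv.apply_eq_smul
  rw [toLin'_apply, mulVec_transpose] at hvA
  obtain ⟨k, hk⟩ := Function.ne_iff.1 hv.2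
  set W : Matrix κ Unit ℂ := replicateCol Unit (star v) with hW
  have hWA : Wᴴ * A = z • Wᴴ := by
    ext i j
    simpa [hW, Matrix.mul_apply, vecMul, dotProduct] using congrFun hvA j
  have hP : (Wᴴ * X * W).PosDef := hX.conjTranspose_mul_mul_same <| by
    rw [← coe_mulVecLin, injective_iff_map_eq_zero]
    intro y hy
    ext i
    have := congrFun hy k
    exact (by simpa [hW, mulVec, dotProduct] using this : v k = 0 ∨ y () = 0).resolve_left hk
  have hL : (((1 : Matrix ι ι ℂ) ⊗ₖ W)ᴴ * -lmiMatrix B C X A * ((1 : Matrix ι ι ℂ) ⊗ₖ W)).PosDef :=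
    h.conjTranspose_mul_mul_same <| by
      rw [← coe_mulVecLin, injective_iff_map_eq_zero]
      intro y hy
      ext ⟨i, _⟩
      have := congrFun hy (i, k)
      exact (by simpa [hW, mulVec, dotProduct, Fintype.sum_prod_type, one_apply] using this :
        v k = 0 ∨ y (i, ()) = 0).resolve_left hk
  set P := Wᴴ * X * W with hPdef
  have h1 : Wᴴ * (A * X) * W = z • P := by
    rw [← Matrix.mul_assoc, hWA, Matrix.smul_mul, Matrix.smul_mul]
  have h2 : Wᴴ * (A * X)ᴴ * W = (starRingEnd ℂ) z • P := by
    have := congrArg conjTranspose h1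
    rw [conjTranspose_smul, hP.isHermitian.eq] at this
    rw [← starRingEnd_apply] at this
    rw [← this]
    simp [Matrix.mul_assoc]
  have h3 : ((1 : Matrix ι ι ℂ) ⊗ₖ W)ᴴ * -lmiMatrix B C X A * ((1 : Matrix ι ι ℂ) ⊗ₖ W) =
      (-(B + z • C + (starRingEnd ℂ) z • Cᴴ)) ⊗ₖ P := by
    simp only [lmiMatrix, conjTranspose_kronecker, conjTranspose_one, Matrix.mul_add, Matrix.mul_neg,
      Matrix.neg_mul, Matrix.add_mul, ← mul_kronecker_mul, Matrix.one_mul, Matrix.mul_one, h1, h2,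
      ← hPdef]
    ext
    simp
    ring
  rw [h3] at hL
  have hc : 0 < (P () ())⁻¹ := inv_pos.2 hP.diag_pos
  have h4 := (hL.submatrix (e := fun i : ι ↦ (i, ())) (fun _ _ h ↦ congrArg Prod.fst h)).smul hc
  convert h4 using 1
  ext i j
  have : P () () ≠ 0 := hP.diag_pos.ne'
  simp only [Matrix.smul_apply, submatrix_apply, kronecker_apply, smul_eq_mul]
  field_simp

theorem map_ofReal_lmiMatrix {ι κ : Type*} [Fintype κ] (B C : Matrix ι ι ℝ) (X A : Matrix κ κ ℝ) :
    (lmiMatrix B C X A).map Complex.ofReal = lmiMatrix (B.map Complex.ofReal)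
      (C.map Complex.ofReal) (X.map Complex.ofReal) (A.map Complex.ofReal) := by
  ext
  simp [lmiMatrix, Matrix.mul_apply]

theorem map_re_lmiMatrix {ι κ : Type*} [Fintype κ] (B C : Matrix ι ι ℝ) (X : Matrix κ κ ℂ)
    (A : Matrix κ κ ℝ) :
    (lmiMatrix (B.map Complex.ofReal) (C.map Complex.ofReal) X (A.map Complex.ofReal)).map
      Complex.re = lmiMatrix B C (X.map Complex.re) A := by
  ext
  simp [lmiMatrix, Matrix.mul_apply]

/-- DH characterization of Ω-stable matrices for a generic LMI region: `A` is Ω-stable iff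
`A = (J - R) Q` with `Jᵀ = -J`, `Rᵀ = R`, `Q ≻ 0`, and
`B ⊗ Q⁻¹ + (C - Cᵀ) ⊗ J - (C + Cᵀ) ⊗ R ≺ 0`. -/
theorem lmi_region_DH_characterization {s n : ℕ}
    (B C : Matrix (Fin s) (Fin s) ℝ) (hB : B.IsSymm)
    (A : Matrix (Fin n) (Fin n) ℝ) :
    (∀ z : ℂ, ((A.map Complex.ofReal).charpoly).IsRoot z →
      (-(B.map Complex.ofReal + z • C.map Complex.ofReal
          + (starRingEnd ℂ z) • (C.map Complex.ofReal)ᵀ)).PosDef)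
    ↔ ∃ J R Q : Matrix (Fin n) (Fin n) ℝ, Jᵀ = -J ∧ Rᵀ = R ∧ Q.PosDef ∧
        A = (J - R) * Q ∧
        (-(B ⊗ₖ Q⁻¹ + (C - Cᵀ) ⊗ₖ J - (C + Cᵀ) ⊗ₖ R)).PosDef := by
  have hCt : (C.map Complex.ofReal)ᵀ = (C.map Complex.ofReal)ᴴ := by
    ext
    simp
  have hlmi (X J R : Matrix (Fin n) (Fin n) ℝ) (hJ : Jᵀ = -J) (hR : Rᵀ = R) (hA : A * X = J - R) :
      B ⊗ₖ X + (C - Cᵀ) ⊗ₖ J - (C + Cᵀ) ⊗ₖ R = lmiMatrix B C X A := by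
    rw [lmiMatrix, hA]
    simp only [conjTranspose_eq_transpose_of_trivial, transpose_sub, hJ, hR]
    ext
    simp
    ring
  rw [hCt]
  constructor
  · intro h
    have hB' : (B.map Complex.ofReal).IsHermitian := by
      ext i j
      simpa using hB.apply i j
    obtain ⟨X, hX, hneg⟩ := exists_posDef_neg_lmiMatrix hB' h
    have hY := hX.map_re
    have hYneg := hneg.map_re
    set Y := X.map Complex.re
    have hYt : Yᵀ = Y := by
      simpa [conjTranspose_eq_transpose_of_trivial] using hY.isHermitian.eq
    have hmap : (-lmiMatrix (B.map Complex.ofReal) (C.map Complex.ofReal) X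
        (A.map Complex.ofReal)).map Complex.re = -lmiMatrix B C Y A := by
      rw [← map_re_lmiMatrix]
      ext
      simp
    rw [hmap] at hYneg
    have hdet : IsUnit Y.det := (Matrix.isUnit_iff_isUnit_det Y).1 hY.isUnit
    have hJ : ((1 / 2 : ℝ) • (A * Y - (A * Y)ᵀ))ᵀ = -((1 / 2 : ℝ) • (A * Y - (A * Y)ᵀ)) := by
      rw [transpose_smul, transpose_sub, transpose_transpose, ← smul_neg, neg_sub]
    have hR : (-(1 / 2 : ℝ) • (A * Y + (A * Y)ᵀ))ᵀ = -(1 / 2 : ℝ) • (A * Y + (A * Y)ᵀ) := by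
      rw [transpose_smul, transpose_add, transpose_transpose, add_comm]
    have hAY : A * Y = (1 / 2 : ℝ) • (A * Y - (A * Y)ᵀ) - -(1 / 2 : ℝ) • (A * Y + (A * Y)ᵀ) := by
      module
    refine ⟨_, _, Y⁻¹, hJ, hR, hY.inv, ?_, ?_⟩
    · rw [← hAY, mul_nonsing_inv_cancel_right _ _ hdet]
    · rwa [nonsing_inv_nonsing_inv _ hdet, hlmi Y _ _ hJ hR hAY]
  · rintro ⟨J, R, Q, hJ, hR, hQ, hA, hneg⟩ z hz
    have hdet : IsUnit Q.det := (Matrix.isUnit_iff_isUnit_det Q).1 hQ.isUnit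
    rw [hlmi Q⁻¹ J R hJ hR (by rw [hA, mul_nonsing_inv_cancel_right _ _ hdet])] at hneg
    refine posDef_of_isRoot_charpoly hQ.inv.map_ofReal ?_ hz
    rw [← map_ofReal_lmiMatrix]
    convert hneg.map_ofReal using 1
    ext
    simp
end

section
/- Let h ∈ ℝ, and let Ω be the right halfplane Ω = {z ∈ ℂ : Re(z) > h}. A real n×n matrix A has all of its complex eigenvalues in Ω if and only if A = (J − R)Q for some real n×n matrices J, R, Q with Jᵀ = −J, Rᵀ = R, Q symmetric positive definite, and such that −hQ⁻¹ − R is positive definite. -/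
open Matrix

section Contraction

open scoped Matrix.Norms.L2Operator ENNReal
open Filter Topology

/-- In a complex Banach algebra, an element whose spectrum lies in the open unit disc has a power
of norm less than one. -/
theorem exists_norm_pow_lt_one_of_spectrum_lt_one {E : Type*} [NormedRing E] [NormedAlgebra ℂ E]
    [CompleteSpace E] [Nontrivial E] (a : E) (ha : ∀ z ∈ spectrum ℂ a, ‖z‖ < 1) :
    ∃ N : ℕ, 0 < N ∧ ‖a ^ N‖ < 1 := by
  have hr : spectralRadius ℂ a < 1 := by
    simpa using spectrum.spectralRadius_lt_of_forall_lt a (r := 1)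
      fun z hz => by simpa [← NNReal.coe_lt_coe] using ha z hz
  have hev := (spectrum.pow_nnnorm_pow_one_div_tendsto_nhds_spectralRadius a).eventually_lt_const hr
  obtain ⟨N, hN, hN0⟩ := (hev.and (eventually_gt_atTop 0)).exists
  refine ⟨N, hN0, ?_⟩
  by_contra! hge
  have h1 : (1 : ℝ≥0∞) ≤ (‖a ^ N‖₊ : ℝ≥0∞) := by
    exact_mod_cast hge
  exact absurd hN (not_lt.2 (ENNReal.one_le_rpow h1 (by positivity)))

/-- If the complexification of a real matrix `K` has operator norm less than one, then
`1 - K * Kᵀ` is positive definite. -/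
theorem Matrix.posDef_one_sub_mul_transpose {ι : Type*} [Fintype ι] [DecidableEq ι]
    (K : Matrix ι ι ℝ) (hK : ‖K.map Complex.ofReal‖ < 1) : (1 - K * Kᵀ).PosDef := by
  refine .of_dotProduct_mulVec_pos ?_ fun x hx => ?_
  · simp [IsHermitian, conjTranspose_eq_transpose_of_trivial]
  have hcast (v : ι → ℝ) : ‖WithLp.toLp 2 (fun i => (v i : ℂ))‖ ^ 2 = v ⬝ᵥ v := by
    rw [EuclideanSpace.norm_sq_eq]
    simp [dotProduct, sq]
  have hle := l2_opNorm_mulVec (K.map Complex.ofReal)ᴴ (WithLp.toLp 2 (fun i => (x i : ℂ)))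
  have hmv : (K.map Complex.ofReal)ᴴ *ᵥ (fun i => (x i : ℂ)) =
      fun i => ((Kᵀ *ᵥ x) i : ℂ) := by
    ext i
    simp [mulVec, dotProduct]
  rw [l2_opNorm_conjTranspose] at hle
  change ‖WithLp.toLp 2 ((K.map Complex.ofReal)ᴴ *ᵥ (fun i => (x i : ℂ)))‖ ≤ _ at hle
  rw [hmv] at hle
  have hpos : 0 < x ⬝ᵥ x := by simpa using dotProduct_star_self_pos_iff.2 hx
  have h1 := hcast x
  have h2 := hcast (Kᵀ *ᵥ x)
  have hxp : 0 < ‖WithLp.toLp 2 (fun i => (x i : ℂ))‖ := by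
    by_contra! h0
    have := le_antisymm h0 (norm_nonneg _)
    rw [this] at h1
    simp [← h1] at hpos
  have hlt := hle.trans_lt (mul_lt_of_lt_one_left hxp hK)
  have hsq := pow_lt_pow_left₀ hlt (norm_nonneg _) two_ne_zero
  rw [h1, h2] at hsq
  have : x ⬝ᵥ ((K * Kᵀ) *ᵥ x) = (Kᵀ *ᵥ x) ⬝ᵥ (Kᵀ *ᵥ x) := by
    rw [← mulVec_mulVec, dotProduct_mulVec, ← mulVec_transpose]
  simpa [sub_mulVec, dotProduct_sub, this] using hsq

/-- Finitely many complex numbers of positive real part are all moved into the open unit disc by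
`w ↦ 1 - δ * w` for some `δ > 0`. -/
theorem exists_pos_forall_norm_one_sub_mul_lt_one {s : Set ℂ} (hs : s.Finite)
    (hpos : ∀ w ∈ s, 0 < w.re) : ∃ δ : ℝ, 0 < δ ∧ ∀ w ∈ s, ‖1 - (δ : ℂ) * w‖ < 1 := by
  have hev : ∀ᶠ δ : ℝ in 𝓝[>] 0, ∀ w ∈ s, ‖1 - (δ : ℂ) * w‖ < 1 := by
    refine (eventually_all_finite hs).2 fun w hw => ?_
    have hlim : Tendsto (fun δ : ℝ => δ * Complex.normSq w) (𝓝[>] 0) (𝓝 0) := by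
      refine tendsto_nhdsWithin_of_tendsto_nhds ?_
      exact Continuous.tendsto' (by fun_prop) _ _ (by simp)
    filter_upwards [hlim.eventually_lt_const (hpos w hw), self_mem_nhdsWithin] with δ h1 h2
    have h2 : 0 < δ := h2
    rw [← sq_lt_one_iff₀ (norm_nonneg _), ← Complex.normSq_eq_norm_sq]
    rw [Complex.normSq_apply] at h1 ⊢
    simp only [Complex.sub_re, Complex.one_re, Complex.re_ofReal_mul, Complex.sub_im,
      Complex.one_im, Complex.im_ofReal_mul]
    nlinarith [mul_pos h2 (hpos w hw), mul_lt_mul_of_pos_left h1 h2]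
  obtain ⟨δ, h1, h2⟩ := (hev.and self_mem_nhdsWithin).exists
  exact ⟨δ, h2, h1⟩

/-- **Lyapunov's theorem**: if all complex eigenvalues of the real matrix `B` have positive real
part, then `B * P + P * Bᵀ` is positive definite for some positive definite `P`. -/
theorem Matrix.exists_posDef_lyapunov {ι : Type*} [Fintype ι] [DecidableEq ι]
    (B : Matrix ι ι ℝ) (hB : ∀ z ∈ spectrum ℂ (B.map Complex.ofReal), 0 < z.re) :
    ∃ P : Matrix ι ι ℝ, P.PosDef ∧ (B * P + P * Bᵀ).PosDef := by
  cases isEmpty_or_nonempty ι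
  · exact ⟨1, .one, by rw [Subsingleton.elim (B * 1 + 1 * Bᵀ) 1]; exact .one⟩
  obtain ⟨δ, hδ, hdisc⟩ := exists_pos_forall_norm_one_sub_mul_lt_one
    (finite_spectrum (B.map Complex.ofReal)) hB
  set M : Matrix ι ι ℝ := 1 - δ • B with hM
  have hMc : M.map Complex.ofReal = Polynomial.aeval (B.map Complex.ofReal)
      (1 - Polynomial.C (δ : ℂ) * Polynomial.X) := by
    ext i j
    by_cases hij : i = j <;> simp [hM, hij, Algebra.algebraMap_eq_smul_one]
  obtain ⟨N, hN0, hN⟩ := exists_norm_pow_lt_one_of_spectrum_lt_one (M.map Complex.ofReal) (by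
    rw [hMc, spectrum.map_polynomial_aeval]
    rintro _ ⟨w, hw, rfl⟩
    simpa using hdisc w hw)
  have hpow : (M ^ N).map Complex.ofReal = M.map Complex.ofReal ^ N :=
    map_pow Complex.ofRealHom.mapMatrix M N
  rw [← hpow] at hN
  set P : Matrix ι ι ℝ := ∑ k ∈ Finset.range N, M ^ k * (M ^ k)ᵀ with hP
  have hstein : M * P * Mᵀ = P - 1 + M ^ N * (M ^ N)ᵀ := by
    have hshift : M * P * Mᵀ = ∑ k ∈ Finset.range N, M ^ (k + 1) * (M ^ (k + 1))ᵀ := by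
      simp only [hP, Finset.mul_sum, Finset.sum_mul, pow_succ' M, transpose_mul, Matrix.mul_assoc]
    have h1 := Finset.sum_range_succ (fun k => M ^ k * (M ^ k)ᵀ) N
    rw [Finset.sum_range_succ'] at h1
    simp only [pow_zero, transpose_one, mul_one] at h1
    rw [hshift, hP, sub_add_eq_add_sub, ← h1, add_sub_cancel_right]
  have hPpos : P.PosDef := by
    obtain ⟨n, rfl⟩ := Nat.exists_eq_succ_of_ne_zero hN0.ne'
    rw [hP, Finset.sum_range_succ']
    simp only [pow_zero, transpose_one, mul_one]
    refine PosDef.posSemidef_add (posSemidef_sum _ fun k _ => ?_) .one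
    simpa [conjTranspose_eq_transpose_of_trivial] using
      posSemidef_self_mul_conjTranspose (M ^ (k + 1))
  refine ⟨P, hPpos, ?_⟩
  have hsemi : (B * P * Bᵀ).PosSemidef := by
    simpa [conjTranspose_eq_transpose_of_trivial] using
      hPpos.posSemidef.mul_mul_conjTranspose_same B
  have hsum := ((posDef_one_sub_mul_transpose _ hN).smul (inv_pos.2 hδ)).add_posSemidef
    (hsemi.smul hδ.le)
  convert hsum using 1
  have hexp : M * P * Mᵀ = P - δ • (B * P + P * Bᵀ) + δ ^ 2 • (B * P * Bᵀ) := by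
    simp only [hM, transpose_sub, transpose_one, transpose_smul, sub_mul, mul_sub, one_mul, mul_one,
      smul_mul_assoc, mul_smul_comm]
    module
  have hK : (1 : Matrix ι ι ℝ) - M ^ N * (M ^ N)ᵀ =
      δ • (B * P + P * Bᵀ) - δ ^ 2 • (B * P * Bᵀ) := by
    rw [hstein] at hexp
    rw [← sub_eq_zero] at hexp ⊢
    rw [← neg_eq_zero, ← hexp]
    abel
  rw [hK, smul_sub, smul_smul, smul_smul, inv_mul_cancel₀ hδ.ne', one_smul, sq,
    inv_mul_cancel_left₀ hδ.ne', sub_add_cancel]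

end Contraction

/-- A root of the characteristic polynomial of a real matrix has a complex left eigenvector, given
here by its real and imaginary parts. -/
theorem Matrix.exists_real_imag_left_eigenvector {ι : Type*} [Fintype ι] [DecidableEq ι]
    (A : Matrix ι ι ℝ) {z : ℂ} (hz : (A.map Complex.ofReal).charpoly.IsRoot z) :
    ∃ a b : ι → ℝ, (a ≠ 0 ∨ b ≠ 0) ∧ a ᵥ* A = z.re • a - z.im • b ∧
      b ᵥ* A = z.im • a + z.re • b := by
  rw [Polynomial.IsRoot, eval_charpoly, ← exists_vecMul_eq_zero_iff] at hz
  obtain ⟨v, hv, hvA⟩ := hz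
  rw [vecMul_sub, sub_eq_zero, eq_comm] at hvA
  have hcoord (i : ι) : ∑ j, v j * (A j i : ℂ) = v i * z := by
    simpa [vecMul, dotProduct, scalar_apply, diagonal_apply] using congrFun hvA i
  refine ⟨fun i => (v i).re, fun i => (v i).im, ?_, ?_, ?_⟩
  · by_contra! h0
    exact hv (funext fun i => Complex.ext (congrFun h0.1 i) (congrFun h0.2 i))
  · ext i
    have := congrArg Complex.re (hcoord i)
    simp only [Complex.re_sum, Complex.mul_re, Complex.ofReal_re, Complex.ofReal_im, mul_zero,
      sub_zero] at this
    simp only [vecMul, dotProduct, this, Pi.sub_apply, Pi.smul_apply, smul_eq_mul]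
    ring
  · ext i
    have := congrArg Complex.im (hcoord i)
    simp only [Complex.im_sum, Complex.mul_im, Complex.ofReal_re, Complex.ofReal_im, mul_zero,
      zero_add] at this
    simp only [vecMul, dotProduct, this, Pi.add_apply, Pi.smul_apply, smul_eq_mul]
    ring

/-- The quadratic form of a skew-symmetric real matrix vanishes. -/
theorem Matrix.dotProduct_mulVec_self_eq_zero {ι : Type*} [Fintype ι] {J : Matrix ι ι ℝ}
    (hJ : Jᵀ = -J) (x : ι → ℝ) : x ⬝ᵥ (J *ᵥ x) = 0 := by
  have h : x ⬝ᵥ (J *ᵥ x) = -(x ⬝ᵥ (J *ᵥ x)) := by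
    conv_lhs =>
      rw [dotProduct_comm, ← vecMul_transpose, hJ, ← dotProduct_mulVec, neg_mulVec, dotProduct_neg]
  linarith

/-- DH characterization of matrices with all eigenvalues in the right halfplane
`{z : Re z > h}`. -/
theorem right_halfplane_stable_iff_DH {n : ℕ} (h : ℝ)
    (A : Matrix (Fin n) (Fin n) ℝ) :
    (∀ z : ℂ, ((A.map Complex.ofReal).charpoly).IsRoot z → h < z.re)
    ↔ ∃ J R Q : Matrix (Fin n) (Fin n) ℝ, Jᵀ = -J ∧ Rᵀ = R ∧ Q.PosDef ∧
        A = (J - R) * Q ∧ ((-h) • Q⁻¹ - R).PosDef := by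
  constructor
  · intro hA
    have hmap : (A - h • (1 : Matrix (Fin n) (Fin n) ℝ)).map Complex.ofReal =
        A.map Complex.ofReal - algebraMap ℂ _ (h : ℂ) := by
      ext i j
      by_cases hij : i = j <;> simp [hij, Algebra.algebraMap_eq_smul_one]
    obtain ⟨P, hP, hlyap⟩ := exists_posDef_lyapunov (A - h • 1) fun z hz => by
      rw [hmap, sub_eq_neg_add, ← spectrum.add_mem_iff, mem_spectrum_iff_isRoot_charpoly] at hz
      have := hA _ hz
      simp at this
      linarith
    have hPt : Pᵀ = P := by
      simpa [IsHermitian, conjTranspose_eq_transpose_of_trivial] using hP.isHermitian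
    have hdet : IsUnit P.det := P.isUnit_iff_isUnit_det.1 hP.isUnit
    refine ⟨(1 / 2 : ℝ) • (A * P - P * Aᵀ), (-1 / 2 : ℝ) • (A * P + P * Aᵀ), P⁻¹, ?_, ?_, hP.inv,
      ?_, ?_⟩
    · simp only [transpose_smul, transpose_sub, transpose_mul, transpose_transpose, hPt]
      module
    · simp only [transpose_smul, transpose_add, transpose_mul, transpose_transpose, hPt]
      module
    · have : (1 / 2 : ℝ) • (A * P - P * Aᵀ) - (-1 / 2 : ℝ) • (A * P + P * Aᵀ) = A * P := by module
      rw [this, mul_nonsing_inv_cancel_right _ _ hdet]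
    · convert hlyap.smul (show (0 : ℝ) < 1 / 2 by norm_num) using 1
      rw [nonsing_inv_nonsing_inv _ hdet]
      simp only [transpose_sub, transpose_smul, transpose_one, sub_mul, mul_sub, smul_mul_assoc,
        mul_smul_comm, one_mul, mul_one]
      module
  · rintro ⟨J, R, Q, hJ, -, hQ, rfl, hpos⟩ z hz
    obtain ⟨a, b, hab, ha, hb⟩ := exists_real_imag_left_eigenvector _ hz
    have hcancel : (J - R) * Q * Q⁻¹ = J - R :=
      mul_nonsing_inv_cancel_right _ _ (Q.isUnit_iff_isUnit_det.1 hQ.isUnit)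
    have hform (x : Fin n → ℝ) :
        (x ᵥ* ((J - R) * Q)) ⬝ᵥ (Q⁻¹ *ᵥ x) = -(x ⬝ᵥ (R *ᵥ x)) := by
      rw [← dotProduct_mulVec, mulVec_mulVec, hcancel, sub_mulVec, dotProduct_sub,
        dotProduct_mulVec_self_eq_zero hJ, zero_sub]
    have hsymm : a ⬝ᵥ (Q⁻¹ *ᵥ b) = b ⬝ᵥ (Q⁻¹ *ᵥ a) := by
      have hQt : (Q⁻¹)ᵀ = Q⁻¹ := by
        simpa [IsHermitian, conjTranspose_eq_transpose_of_trivial] using hQ.inv.isHermitian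
      rw [dotProduct_comm, ← vecMul_transpose, hQt, ← dotProduct_mulVec]
    have hfa := hform a
    have hfb := hform b
    rw [ha, sub_dotProduct, smul_dotProduct, smul_dotProduct] at hfa
    rw [hb, add_dotProduct, smul_dotProduct, smul_dotProduct] at hfb
    simp only [hsymm, smul_eq_mul] at hfa hfb
    have hposSum {T : Matrix (Fin n) (Fin n) ℝ} (hT : T.PosDef) :
        0 < a ⬝ᵥ (T *ᵥ a) + b ⬝ᵥ (T *ᵥ b) := by
      have ha0 : 0 ≤ a ⬝ᵥ (T *ᵥ a) := by simpa using hT.posSemidef.dotProduct_mulVec_nonneg a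
      have hb0 : 0 ≤ b ⬝ᵥ (T *ᵥ b) := by simpa using hT.posSemidef.dotProduct_mulVec_nonneg b
      rcases hab with hne | hne
      · have : 0 < a ⬝ᵥ (T *ᵥ a) := by simpa using hT.dotProduct_mulVec_pos hne
        linarith
      · have : 0 < b ⬝ᵥ (T *ᵥ b) := by simpa using hT.dotProduct_mulVec_pos hne
        linarith
    have h1 := hposSum hQ.inv
    have h2 := hposSum hpos
    simp only [sub_mulVec, smul_mulVec, dotProduct_sub, dotProduct_smul, smul_eq_mul] at h2
    refine lt_of_mul_lt_mul_right ?_ h1.le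
    linarith
end
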